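/- Let d ≥ 2 and r > d. There exist ε_* > 0 and C > 0, independent of T, such that for every ε ∈ [0, ε_*] and every T ∈ (0,∞) the damped/driven wave kinetic equation with zero data at τ = −T has a solution m* : [−T,∞) → C_r(ℝ^d) with sup_{τ≥−T} ‖m*(τ)‖_r ≤ C, and this solution is unique among all bounded continuous curves [−T,∞) → C_r(ℝ^d) satisfying the equation. -/

import Mathlib

open MeasureTheory

noncomputable section

/-- `ℝ^d` with its Euclidean structure. -/
abbrev Rd (d : ℕ) := EuclideanSpace ℝ (Fin d)

/-- Integral of `f` over the hyperplane `x^⊥ = {z : x·z = 0}` with respect to the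
`(d-1)`-dimensional Lebesgue measure induced by the Euclidean inner product. -/
noncomputable def hyperplaneIntegral (d : ℕ) (x : Rd d) (f : Rd d → ℝ) : ℝ :=
  ∫ z : ((ℝ ∙ x)ᗮ : Submodule ℝ (Rd d)), f (z : Rd d)

/-- The weighted sup-norm `‖y‖_r = sup_s (1+|s|)^r |y(s)|`. -/
noncomputable def wNorm (d : ℕ) (r : ℝ) (y : Rd d → ℝ) : ℝ :=
  ⨆ s : Rd d, (1 + ‖s‖) ^ r * |y s|

/-- Membership in the space `C_r(ℝ^d)` of continuous functions with finite `‖·‖_r`. -/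
def memCr (d : ℕ) (r : ℝ) (y : Rd d → ℝ) : Prop :=
  Continuous y ∧ ∃ K : ℝ, ∀ s : Rd d, (1 + ‖s‖) ^ r * |y s| ≤ K

/-- The integrand of the wave kinetic integral. -/
noncomputable def kinIntegrand (d : ℕ) (y : Rd d → ℝ) (s x z : Rd d) : ℝ :=
  y (s + x) * y (s + z) * y (s + x + z) + y (s + x) * y (s + z) * y s
    - y (s + z) * y (s + x + z) * y s - y (s + x) * y (s + x + z) * y s

/-- The wave kinetic integral
`K_s(y) = 2π ∫_{ℝ^d} |x|⁻¹ (∫_{x^⊥} [...] dz) dx`. -/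
noncomputable def Kwk (d : ℕ) (y : Rd d → ℝ) (s : Rd d) : ℝ :=
  2 * Real.pi * ∫ x : Rd d, ‖x‖⁻¹ * hyperplaneIntegral d x (kinIntegrand d y s x)

/-- `γ_s = (1+|s|²)^{r_*}`. -/
noncomputable def gam (d : ℕ) (rstar : ℝ) (s : Rd d) : ℝ := (1 + ‖s‖ ^ 2) ^ rstar

/-- A (bounded continuous, mild-form) solution of the damped/driven wave kinetic equation
`ṁ_s = −2γ_s m_s + 2 b_s² + ε K_s(m)` with zero data at `τ = −T`:
a curve `m : [−T,∞) → C_r(ℝ^d)` which is bounded, continuous in the `‖·‖_r`-norm, and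
satisfies `m_s(τ) = ∫_{−T}^τ e^{−2γ_s(τ−l)} (2 b(s)² + ε K_s(m(l))) dl`. -/
def IsWKESol (d : ℕ) (r rstar : ℝ) (b : Rd d → ℝ) (T ε : ℝ)
    (m : ℝ → Rd d → ℝ) : Prop :=
  (∀ τ ∈ Set.Ici (-T), memCr d r (m τ)) ∧
  (∃ K : ℝ, ∀ τ ∈ Set.Ici (-T), wNorm d r (m τ) ≤ K) ∧
  (∀ τ₀ ∈ Set.Ici (-T), ∀ δ : ℝ, 0 < δ → ∃ η : ℝ, 0 < η ∧ ∀ τ ∈ Set.Ici (-T),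
      |τ - τ₀| < η → wNorm d r (fun s => m τ s - m τ₀ s) < δ) ∧
  (∀ τ ∈ Set.Ici (-T), ∀ s : Rd d,
      m τ s = ∫ l in Set.Icc (-T) τ,
        Real.exp (-2 * gam d rstar s * (τ - l)) * (2 * (b s) ^ 2 + ε * Kwk d (m l) s))

/-- The weight `(1 + |u|)^{-r}` dominating the unit ball of `C_r`. -/
def decay (d : ℕ) (r : ℝ) (u : Rd d) : ℝ := (1 + ‖u‖) ^ (-r)

/-- The reflection of `ℝ^d` exchanging `e` and `x / |x|` when `|e| = 1` and `x ≠ 0`. -/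
@[irreducible] def hyperRefl {d : ℕ} (e x : Rd d) : Rd d ≃ₗᵢ[ℝ] Rd d :=
  (ℝ ∙ (e - ‖x‖⁻¹ • x))ᗮ.reflection

lemma hyperRefl_apply {d : ℕ} (e x z : Rd d) :
    hyperRefl e x z = z - (2 * (inner ℝ (e - ‖x‖⁻¹ • x) z / ‖e - ‖x‖⁻¹ • x‖ ^ 2)) •
      (e - ‖x‖⁻¹ • x) := by
  rw [hyperRefl, Submodule.reflection_orthogonal_apply, Submodule.reflection_singleton_apply,
    two_smul, mul_smul, two_smul]
  simp

lemma measurable_hyperRefl {d : ℕ} (e : Rd d) :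
    Measurable fun p : Rd d × Rd d => hyperRefl e p.1 p.2 := by
  simp_rw [hyperRefl_apply]
  fun_prop

lemma map_hyperRefl {d : ℕ} {e x : Rd d} (he : ‖e‖ = 1) (hx : x ≠ 0) :
    (ℝ ∙ e)ᗮ.map ((hyperRefl e x).toLinearEquiv : Rd d →ₗ[ℝ] Rd d) = (ℝ ∙ x)ᗮ := by
  have h1 : hyperRefl e x e = ‖x‖⁻¹ • x := by
    rw [hyperRefl]
    apply Submodule.reflection_sub
    rw [he, norm_smul, norm_inv, norm_norm, inv_mul_cancel₀ (norm_ne_zero_iff.2 hx)]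
  have h2 : (ℝ ∙ e).map ((hyperRefl e x).toLinearEquiv : Rd d →ₗ[ℝ] Rd d) = ℝ ∙ x := by
    rw [Submodule.map_span, Set.image_singleton]
    change (ℝ ∙ (hyperRefl e x e)) = _
    rw [h1]
    exact Submodule.span_singleton_smul_eq (IsUnit.mk0 _ (by simpa using hx)) x
  rw [Submodule.map_orthogonal_equiv, h2]

lemma integral_submodule_map {d : ℕ} (p q : Submodule ℝ (Rd d)) (φ : Rd d ≃ₗᵢ[ℝ] Rd d)
    (h : p.map (φ.toLinearEquiv : Rd d →ₗ[ℝ] Rd d) = q) (f : Rd d → ℝ) :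
    ∫ z : q, f z = ∫ w : p, f (φ w) := by
  subst h
  exact ((LinearIsometryEquiv.submoduleMap p φ).measurePreserving.integral_comp'
    (f := (LinearIsometryEquiv.submoduleMap p φ).toMeasurableEquiv) (fun z => f z)).symm

lemma hyperplaneIntegral_eq {d : ℕ} {e x : Rd d} (he : ‖e‖ = 1) (hx : x ≠ 0) (f : Rd d → ℝ) :
    hyperplaneIntegral d x f = ∫ w : (ℝ ∙ e)ᗮ, f (hyperRefl e x w) :=
  integral_submodule_map _ _ _ (map_hyperRefl he hx) f

section Weights

variable {d : ℕ} {r : ℝ}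

lemma decay_nonneg (u : Rd d) : 0 ≤ decay d r u := by
  unfold decay; positivity

lemma decay_pos (u : Rd d) : 0 < decay d r u := by
  unfold decay; positivity

lemma decay_le_one (hr : 0 ≤ r) (u : Rd d) : decay d r u ≤ 1 :=
  Real.rpow_le_one_of_one_le_of_nonpos (by simp) (by simpa)

lemma rpow_mul_decay (u : Rd d) : (1 + ‖u‖) ^ r * decay d r u = 1 := by
  rw [decay, ← Real.rpow_add (by positivity)]; simp

lemma continuous_decay : Continuous (decay d r) := by
  unfold decay
  exact (continuous_const.add continuous_norm).rpow_const fun u =>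
    Or.inl (add_pos_of_pos_of_nonneg one_pos (norm_nonneg u)).ne'

@[fun_prop]
lemma measurable_decay : Measurable (decay d r) := continuous_decay.measurable

/-- If `1 + |v| ≤ c (1 + |u|)` then `decay u ≤ c^r decay v`. -/
lemma decay_le_of_le (hr : 0 ≤ r) {c : ℝ} (hc : 0 < c) {u v : Rd d}
    (h : 1 + ‖v‖ ≤ c * (1 + ‖u‖)) : decay d r u ≤ c ^ r * decay d r v := by
  have h1 : (1 + ‖v‖) ^ r ≤ c ^ r * (1 + ‖u‖) ^ r := by
    rw [← Real.mul_rpow hc.le (by positivity)]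
    exact Real.rpow_le_rpow (by positivity) h hr
  have h2 := mul_le_mul_of_nonneg_right h1
    (mul_nonneg (decay_nonneg (r := r) u) (decay_nonneg (r := r) v))
  calc decay d r u = (1 + ‖v‖) ^ r * decay d r v * decay d r u := by rw [rpow_mul_decay, one_mul]
    _ ≤ c ^ r * decay d r v * ((1 + ‖u‖) ^ r * decay d r u) := by linarith
    _ = c ^ r * decay d r v := by rw [rpow_mul_decay, mul_one]

lemma decay_add_le (hr : 0 ≤ r) (s u : Rd d) :
    decay d r (s + u) ≤ (1 + ‖s‖) ^ r * decay d r u := by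
  refine decay_le_of_le hr (by positivity) ?_
  have : ‖u‖ ≤ ‖s‖ + ‖s + u‖ := by
    simpa using norm_sub_le (s + u) s |>.trans_eq (add_comm _ _)
  nlinarith [norm_nonneg s, norm_nonneg (s + u)]

/-- The sum of the pairwise products of the decay weights at `s + x`, `s + z`, `s + x + z`. -/
def pairDecay (d : ℕ) (r : ℝ) (s x z : Rd d) : ℝ :=
  decay d r (s + x) * decay d r (s + z) + decay d r (s + z) * decay d r (s + x + z)
    + decay d r (s + x) * decay d r (s + x + z)

lemma pairDecay_nonneg (s x z : Rd d) : 0 ≤ pairDecay d r s x z := by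
  have ha := decay_nonneg (r := r) (s + x)
  have hb := decay_nonneg (r := r) (s + z)
  have hc := decay_nonneg (r := r) (s + x + z)
  exact add_nonneg (add_nonneg (mul_nonneg ha hb) (mul_nonneg hb hc)) (mul_nonneg ha hc)

lemma pairDecay_le (hr : 0 ≤ r) (s x z : Rd d) :
    pairDecay d r s x z ≤ ((1 + ‖s‖) ^ r) ^ 2 * pairDecay d r 0 x z := by
  have h0 := @decay_nonneg d r
  have h1 := decay_add_le hr s x
  have h2 := decay_add_le hr s z
  have h3 := decay_add_le hr s (x + z)
  rw [← add_assoc] at h3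
  have h12 := mul_le_mul h1 h2 (h0 _) ((h0 _).trans h1)
  have h23 := mul_le_mul h2 h3 (h0 _) ((h0 _).trans h2)
  have h13 := mul_le_mul h1 h3 (h0 _) ((h0 _).trans h1)
  simp only [pairDecay, zero_add]
  linarith

lemma decay_triple_le (hr : 0 ≤ r) (s x z : Rd d) :
    decay d r (s + x) * decay d r (s + z) * decay d r (s + x + z)
      ≤ 3 ^ r * decay d r s * pairDecay d r s x z := by
  have h0 := @decay_nonneg d r
  have key : ‖s‖ ≤ ‖s + x‖ + ‖s + z‖ + ‖s + x + z‖ := by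
    have h : s = (s + x) + (s + z) - (s + x + z) := by abel
    calc ‖s‖ = ‖(s + x) + (s + z) - (s + x + z)‖ := by rw [← h]
      _ ≤ _ := (norm_sub_le _ _).trans (by gcongr; exact norm_add_le _ _)
  have ha := h0 (s + x)
  have hb := h0 (s + z)
  have hc := h0 (s + x + z)
  have hs : 0 ≤ 3 ^ r * decay d r s := mul_nonneg (by positivity) (h0 s)
  have hab := mul_nonneg hs (mul_nonneg ha hb)
  have hac := mul_nonneg hs (mul_nonneg ha hc)
  have hbc := mul_nonneg hs (mul_nonneg hb hc)
  unfold pairDecay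
  have hcases : ‖s‖ ≤ 3 * ‖s + x‖ ∨ ‖s‖ ≤ 3 * ‖s + z‖ ∨ ‖s‖ ≤ 3 * ‖s + x + z‖ := by
    by_contra! h
    linarith
  rcases hcases with h | h | h
  · have := decay_le_of_le hr (c := 3) (by norm_num) (u := s + x) (v := s) (by linarith)
    nlinarith [mul_le_mul_of_nonneg_right this (mul_nonneg hb hc)]
  · have := decay_le_of_le hr (c := 3) (by norm_num) (u := s + z) (v := s) (by linarith)
    nlinarith [mul_le_mul_of_nonneg_right this (mul_nonneg ha hc)]
  · have := decay_le_of_le hr (c := 3) (by norm_num) (u := s + x + z) (v := s) (by linarith)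
    nlinarith [mul_le_mul_of_nonneg_right this (mul_nonneg ha hb)]

/-- The middle term of `pairDecay` decays in `x` uniformly in `s`. -/
lemma decay_mul_decay_le (hr : 0 ≤ r) (s x z : Rd d) :
    decay d r (s + z) * decay d r (s + x + z)
      ≤ 2 ^ r * decay d r x * (decay d r (s + z) + decay d r (s + x + z)) := by
  have h0 := @decay_nonneg d r
  have key : ‖x‖ ≤ ‖s + z‖ + ‖s + x + z‖ := by
    have h : x = (s + x + z) - (s + z) := by abel
    calc ‖x‖ = ‖(s + x + z) - (s + z)‖ := by rw [← h]
      _ ≤ _ := (norm_sub_le _ _).trans_eq (add_comm _ _)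
  have hb := h0 (s + z)
  have hc := h0 (s + x + z)
  have hs : 0 ≤ 2 ^ r * decay d r x := mul_nonneg (by positivity) (h0 x)
  have hsb := mul_nonneg hs hb
  have hsc := mul_nonneg hs hc
  have hcases : ‖x‖ ≤ 2 * ‖s + z‖ ∨ ‖x‖ ≤ 2 * ‖s + x + z‖ := by
    by_contra! h
    linarith
  rcases hcases with h | h
  · have := decay_le_of_le hr (c := 2) (by norm_num) (u := s + z) (v := x) (by linarith)
    nlinarith [mul_le_mul_of_nonneg_right this hc]
  · have := decay_le_of_le hr (c := 2) (by norm_num) (u := s + x + z) (v := x) (by linarith)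
    nlinarith [mul_le_mul_of_nonneg_right this hb]

end Weights

section Kernel

variable {d : ℕ} {r : ℝ}

lemma lintegral_decay_hyperRefl_le (hr : 0 ≤ r) (e x a : Rd d) :
    ∫⁻ w : (ℝ ∙ e)ᗮ, ENNReal.ofReal (decay d r (a + hyperRefl e x w))
      ≤ ∫⁻ w : (ℝ ∙ e)ᗮ, ENNReal.ofReal ((1 + ‖w‖) ^ (-r)) := by
  set a' := (hyperRefl e x).symm a with ha'
  set q := (ℝ ∙ e)ᗮ.orthogonalProjectionOnto a' with hq
  rw [← lintegral_add_left_eq_self (fun w : (ℝ ∙ e)ᗮ => ENNReal.ofReal ((1 + ‖w‖) ^ (-r))) q]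
  refine lintegral_mono fun w => ENNReal.ofReal_le_ofReal ?_
  have h1 : ‖a + hyperRefl e x w‖ = ‖a' + w‖ := by
    rw [← (hyperRefl e x).norm_map (a' + w), map_add, ha', LinearIsometryEquiv.apply_symm_apply]
  have h2 : (ℝ ∙ e)ᗮ.orthogonalProjectionOnto (a' + w) = q + w := by
    rw [map_add, Submodule.orthogonalProjectionOnto_mem_subspace_eq_self]
  refine Real.rpow_le_rpow_of_nonpos (by positivity) ?_ (by linarith)
  rw [h1, ← h2]
  gcongr
  exact Submodule.norm_orthogonalProjectionOnto_apply_le _ _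

lemma lintegral_decay_lt_top (hr : (d : ℝ) < r) :
    ∫⁻ x : Rd d, ENNReal.ofReal (decay d r x) < ⊤ := by
  unfold decay
  exact finite_integral_one_add_norm (by simpa using hr)

lemma lintegral_decay_hyperplane_lt_top (hr : (d : ℝ) < r) (e : Rd d) :
    ∫⁻ w : (ℝ ∙ e)ᗮ, ENNReal.ofReal ((1 + ‖w‖) ^ (-r)) < ⊤ := by
  refine finite_integral_one_add_norm (lt_of_le_of_lt ?_ hr)
  have := Submodule.finrank_le (ℝ ∙ e)ᗮ
  rw [finrank_euclideanSpace_fin] at this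
  exact_mod_cast this

lemma integrable_indicator_norm_inv (hd : 2 ≤ d) :
    Integrable fun x : Rd d => (Set.Iic (1 : ℝ)).indicator (fun t => t⁻¹) ‖x‖ := by
  have : Nontrivial (Rd d) := by
    apply Module.nontrivial_of_finrank_pos (R := ℝ)
    rw [finrank_euclideanSpace_fin]
    omega
  rw [integrable_fun_norm_addHaar volume (f := (Set.Iic (1 : ℝ)).indicator fun t => t⁻¹),
    finrank_euclideanSpace_fin]
  have h1 : IntegrableOn (fun t : ℝ => t ^ (d - 2)) (Set.Ioc 0 1) :=
    ((continuous_pow _).integrableOn_Icc (a := 0) (b := 1)).mono_set Set.Ioc_subset_Icc_self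
  have h2 : IntegrableOn ((Set.Iic (1 : ℝ)).indicator fun t => t ^ (d - 2)) (Set.Ioi 0) := by
    rw [IntegrableOn, integrable_indicator_iff measurableSet_Iic, IntegrableOn,
      Measure.restrict_restrict measurableSet_Iic, Set.inter_comm, Set.Ioi_inter_Iic]
    exact h1
  refine h2.congr_fun (fun t ht => ?_) measurableSet_Ioi
  by_cases h : t ∈ Set.Iic (1 : ℝ)
  · have ht' : t ≠ 0 := (Set.mem_Ioi.1 ht).ne'
    simp only [Set.indicator_of_mem h, smul_eq_mul]
    rw [show d - 1 = (d - 2) + 1 by omega, pow_succ, mul_assoc, mul_inv_cancel₀ ht', mul_one]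
  · simp [Set.indicator_of_notMem h]

lemma exists_lintegral_norm_inv_mul_decay_le (hd : 2 ≤ d) (hr : (d : ℝ) < r) :
    ∃ C : ENNReal, C ≠ ⊤ ∧
      ∀ a : Rd d, ∫⁻ x : Rd d, ENNReal.ofReal (‖x‖⁻¹ * decay d r (a + x)) ≤ C := by
  have hr0 : 0 ≤ r := (Nat.cast_nonneg d).trans hr.le
  set f : Rd d → ℝ := fun x => (Set.Iic (1 : ℝ)).indicator (fun t => t⁻¹) ‖x‖ with hf
  have hfi : Integrable f := integrable_indicator_norm_inv hd
  have hf0 : ∀ x, 0 ≤ f x := fun x => by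
    by_cases h : ‖x‖ ∈ Set.Iic (1 : ℝ)
    · simp [hf, Set.indicator_of_mem h]
    · simp [hf, Set.indicator_of_notMem h]
  have hfm : Measurable f :=
    (measurable_inv.indicator measurableSet_Iic).comp measurable_norm
  refine ⟨(∫⁻ x, ENNReal.ofReal (f x)) + ∫⁻ x : Rd d, ENNReal.ofReal (decay d r x),
    ENNReal.add_ne_top.2 ⟨hfi.lintegral_lt_top.ne, (lintegral_decay_lt_top hr).ne⟩, fun a => ?_⟩
  rw [← lintegral_add_left_eq_self (fun x : Rd d => ENNReal.ofReal (decay d r x)) a,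
    ← lintegral_add_left (by fun_prop)]
  refine lintegral_mono fun x => ?_
  rw [← ENNReal.ofReal_add (hf0 x) (decay_nonneg _)]
  refine ENNReal.ofReal_le_ofReal ?_
  have h1 := decay_le_one hr0 (a + x)
  have h2 := decay_nonneg (r := r) (a + x)
  by_cases h : ‖x‖ ∈ Set.Iic (1 : ℝ)
  · simp only [hf, Set.indicator_of_mem h]
    nlinarith [inv_nonneg.2 (norm_nonneg x)]
  · simp only [hf, Set.indicator_of_notMem h]
    have h3 : ‖x‖⁻¹ ≤ 1 := inv_le_one_of_one_le₀ (not_le.1 h).le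
    nlinarith

/-- The dominating kernel of the wave kinetic integral, written over `ℝ^d × e^⊥`. -/
def domKernel (d : ℕ) (r : ℝ) (e s : Rd d) (p : Rd d × (ℝ ∙ e)ᗮ) : ℝ :=
  ‖p.1‖⁻¹ * pairDecay d r s p.1 (hyperRefl e p.1 p.2)

lemma domKernel_nonneg (e s : Rd d) (p : Rd d × (ℝ ∙ e)ᗮ) : 0 ≤ domKernel d r e s p :=
  mul_nonneg (by positivity) (pairDecay_nonneg _ _ _)

lemma measurable_hyperRefl_coe (e : Rd d) :
    Measurable fun p : Rd d × (ℝ ∙ e)ᗮ => hyperRefl e p.1 p.2 :=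
  (measurable_hyperRefl e).comp
    (measurable_fst.prodMk (measurable_subtype_coe.comp measurable_snd))

lemma measurable_domKernel (e s : Rd d) : Measurable (domKernel d r e s) := by
  have h : Measurable fun q : Rd d × Rd d => ‖q.1‖⁻¹ * pairDecay d r s q.1 q.2 := by
    unfold pairDecay
    fun_prop
  have h' := h.comp (measurable_fst.prodMk (measurable_hyperRefl_coe e))
  simp only [Function.comp_def] at h'
  unfold domKernel
  exact h'

lemma exists_lintegral_domKernel_le (hd : 2 ≤ d) (hr : (d : ℝ) < r) (e : Rd d) :
    ∃ M : ENNReal, M ≠ ⊤ ∧ ∀ s : Rd d,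
      ∫⁻ p, ENNReal.ofReal (domKernel d r e s p) ∂(volume.prod volume) ≤ M := by
  have hr0 : 0 ≤ r := (Nat.cast_nonneg d).trans hr.le
  obtain ⟨C, hC, hCle⟩ := exists_lintegral_norm_inv_mul_decay_le hd hr
  set C₁ := ∫⁻ w : (ℝ ∙ e)ᗮ, ENNReal.ofReal ((1 + ‖w‖) ^ (-r))
  have hC₁ : C₁ ≠ ⊤ := (lintegral_decay_hyperplane_lt_top hr e).ne
  refine ⟨(C + ENNReal.ofReal (2 ^ r) * C) * (C₁ + C₁), by finiteness, fun s => ?_⟩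
  set k : Rd d → Rd d → ENNReal := fun a x => ENNReal.ofReal (‖x‖⁻¹ * decay d r (a + x)) with hk
  have hkm : ∀ a, Measurable (k a) := fun a => by fun_prop
  have hbound : ∀ p : Rd d × (ℝ ∙ e)ᗮ, ENNReal.ofReal (domKernel d r e s p) ≤
      (k s p.1 + ENNReal.ofReal (2 ^ r) * k 0 p.1) *
        (ENNReal.ofReal (decay d r (s + hyperRefl e p.1 p.2)) +
          ENNReal.ofReal (decay d r (s + p.1 + hyperRefl e p.1 p.2))) := by
    rintro ⟨x, w⟩
    have h0 := @decay_nonneg d r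
    have hx : 0 ≤ ‖x‖⁻¹ := by positivity
    simp only [hk]
    rw [← ENNReal.ofReal_mul (by positivity), ← ENNReal.ofReal_add (mul_nonneg hx (h0 _))
      (mul_nonneg (by positivity) (mul_nonneg hx (h0 _))), ← ENNReal.ofReal_add (h0 _) (h0 _),
      ← ENNReal.ofReal_mul (add_nonneg (mul_nonneg hx (h0 _))
      (mul_nonneg (by positivity) (mul_nonneg hx (h0 _))))]
    refine ENNReal.ofReal_le_ofReal ?_
    have := mul_le_mul_of_nonneg_left (decay_mul_decay_le hr0 s x (hyperRefl e x w)) hx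
    simp only [domKernel, pairDecay, zero_add]
    linarith
  calc ∫⁻ p, ENNReal.ofReal (domKernel d r e s p) ∂(volume.prod volume)
      = ∫⁻ x, ∫⁻ w, ENNReal.ofReal (domKernel d r e s (x, w)) :=
        lintegral_prod _ (measurable_domKernel e s).ennreal_ofReal.aemeasurable
    _ ≤ ∫⁻ x, (k s x + ENNReal.ofReal (2 ^ r) * k 0 x) * (C₁ + C₁) := by
        refine lintegral_mono fun x => (lintegral_mono fun w => hbound (x, w)).trans ?_
        have hm : Measurable fun w : (ℝ ∙ e)ᗮ => hyperRefl e x w :=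
          (hyperRefl e x).continuous.measurable.comp measurable_subtype_coe
        dsimp only
        rw [lintegral_const_mul _ (by fun_prop), lintegral_add_left (by fun_prop)]
        gcongr
        · exact lintegral_decay_hyperRefl_le hr0 e x s
        · exact lintegral_decay_hyperRefl_le hr0 e x (s + x)
    _ ≤ (C + ENNReal.ofReal (2 ^ r) * C) * (C₁ + C₁) := by
        rw [lintegral_mul_const _ (by fun_prop), lintegral_add_left (hkm s),
          lintegral_const_mul _ (hkm 0)]
        gcongr
        · exact hCle s
        · exact hCle 0

lemma exists_integral_domKernel_le (hd : 2 ≤ d) (hr : (d : ℝ) < r) (e : Rd d) :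
    ∃ M : ℝ, 0 ≤ M ∧ ∀ s : Rd d, Integrable (domKernel d r e s) (volume.prod volume) ∧
      ∫ p, domKernel d r e s p ∂(volume.prod volume) ≤ M := by
  obtain ⟨M, hM, hle⟩ := exists_lintegral_domKernel_le hd hr e
  refine ⟨M.toReal, ENNReal.toReal_nonneg, fun s => ⟨?_, ?_⟩⟩
  · refine ⟨(measurable_domKernel e s).aestronglyMeasurable, ?_⟩
    rw [hasFiniteIntegral_iff_ofReal (.of_forall (domKernel_nonneg e s))]
    exact (hle s).trans_lt hM.lt_top
  · rw [integral_eq_lintegral_of_nonneg_ae (.of_forall (domKernel_nonneg e s))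
      (measurable_domKernel e s).aestronglyMeasurable]
    exact ENNReal.toReal_mono hM (hle s)

end Kernel

section Collision

variable {d : ℕ} {r : ℝ}

lemma abs_mul_mul_sub_le {R D P Q S p₁ p₂ q₁ q₂ t₁ t₂ : ℝ} (hP : 0 ≤ P) (hQ : 0 ≤ Q)
    (hR : 0 ≤ R) (hp₂ : |p₂| ≤ R * P) (hp : |p₁ - p₂| ≤ D * P)
    (hq₁ : |q₁| ≤ R * Q) (hq₂ : |q₂| ≤ R * Q) (hq : |q₁ - q₂| ≤ D * Q)
    (ht₁ : |t₁| ≤ R * S) (ht : |t₁ - t₂| ≤ D * S) :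
    |p₁ * q₁ * t₁ - p₂ * q₂ * t₂| ≤ 3 * R ^ 2 * D * (P * Q * S) := by
  have hRP := mul_nonneg hR hP
  have hRQ := mul_nonneg hR hQ
  have h : p₁ * q₁ * t₁ - p₂ * q₂ * t₂
      = (p₁ - p₂) * q₁ * t₁ + p₂ * (q₁ - q₂) * t₁ + p₂ * q₂ * (t₁ - t₂) := by ring
  have h1 : |(p₁ - p₂) * q₁ * t₁| ≤ (D * P) * (R * Q) * (R * S) := by
    rw [abs_mul, abs_mul]
    have := (abs_nonneg _).trans hp
    gcongr
  have h2 : |p₂ * (q₁ - q₂) * t₁| ≤ (R * P) * (D * Q) * (R * S) := by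
    rw [abs_mul, abs_mul]
    have := (abs_nonneg _).trans hq
    gcongr
  have h3 : |p₂ * q₂ * (t₁ - t₂)| ≤ (R * P) * (R * Q) * (D * S) := by
    rw [abs_mul, abs_mul]
    gcongr
  rw [h]
  refine (abs_add_three _ _ _).trans ?_
  linarith

lemma abs_kinIntegrand_sub_le (hr : 0 ≤ r) {R D : ℝ} {y₁ y₂ : Rd d → ℝ}
    (h₁ : ∀ u, |y₁ u| ≤ R * decay d r u) (h₂ : ∀ u, |y₂ u| ≤ R * decay d r u)
    (h : ∀ u, |y₁ u - y₂ u| ≤ D * decay d r u) (s x z : Rd d) :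
    |kinIntegrand d y₁ s x z - kinIntegrand d y₂ s x z|
      ≤ 3 * R ^ 2 * D * (3 ^ r + 1) * decay d r s * pairDecay d r s x z := by
  have h0 := @decay_nonneg d r
  have hR : 0 ≤ R := nonneg_of_mul_nonneg_left ((abs_nonneg _).trans (h₁ s)) (decay_pos s)
  have hD : 0 ≤ D := nonneg_of_mul_nonneg_left ((abs_nonneg _).trans (h s)) (decay_pos s)
  have key : ∀ u v w : Rd d, |y₁ u * y₁ v * y₁ w - y₂ u * y₂ v * y₂ w|
      ≤ 3 * R ^ 2 * D * (decay d r u * decay d r v * decay d r w) := fun u v w =>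
    abs_mul_mul_sub_le (h0 u) (h0 v) hR (h₂ u) (h u) (h₁ v) (h₂ v) (h v) (h₁ w) (h w)
  have k1 := abs_le.1 (key (s + x) (s + z) (s + x + z))
  have k2 := abs_le.1 (key (s + x) (s + z) s)
  have k3 := abs_le.1 (key (s + z) (s + x + z) s)
  have k4 := abs_le.1 (key (s + x) (s + x + z) s)
  have hc : 0 ≤ 3 * R ^ 2 * D := by positivity
  have ht := mul_le_mul_of_nonneg_left (decay_triple_le hr s x z) hc
  have hsum : 3 * R ^ 2 * D * (3 ^ r + 1) * decay d r s * pairDecay d r s x z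
      = 3 * R ^ 2 * D * (3 ^ r * decay d r s * pairDecay d r s x z)
        + 3 * R ^ 2 * D * (decay d r (s + x) * decay d r (s + z) * decay d r s)
        + 3 * R ^ 2 * D * (decay d r (s + z) * decay d r (s + x + z) * decay d r s)
        + 3 * R ^ 2 * D * (decay d r (s + x) * decay d r (s + x + z) * decay d r s) := by
    unfold pairDecay; ring
  rw [hsum]
  unfold kinIntegrand
  exact abs_le.2 ⟨by linarith [k1.1, k2.1, k3.2, k4.2], by linarith [k1.2, k2.2, k3.1, k4.1]⟩

lemma abs_kinIntegrand_le (hr : 0 ≤ r) {R : ℝ} {y : Rd d → ℝ}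
    (h : ∀ u, |y u| ≤ R * decay d r u) (s x z : Rd d) :
    |kinIntegrand d y s x z|
      ≤ 3 * R ^ 2 * R * (3 ^ r + 1) * decay d r s * pairDecay d r s x z := by
  have := abs_kinIntegrand_sub_le hr h (y₂ := fun _ => 0)
    (fun u => by simpa using (abs_nonneg _).trans (h u)) (by simpa using h) s x z
  simpa [kinIntegrand] using this

/-- The integrand of the wave kinetic integral, written over `ℝ^d × e^⊥`. -/
def flatIntegrand (d : ℕ) (e : Rd d) (y : Rd d → ℝ) (s : Rd d) (p : Rd d × (ℝ ∙ e)ᗮ) : ℝ :=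
  ‖p.1‖⁻¹ * kinIntegrand d y s p.1 (hyperRefl e p.1 p.2)

lemma measurable_flatIntegrand {y : Rd d → ℝ} (hy : Continuous y) (e s : Rd d) :
    Measurable (flatIntegrand d e y s) := by
  have h : Measurable fun q : Rd d × Rd d => ‖q.1‖⁻¹ * kinIntegrand d y s q.1 q.2 := by
    have := hy.measurable
    unfold kinIntegrand
    fun_prop
  have h' := h.comp (measurable_fst.prodMk (measurable_hyperRefl_coe e))
  simp only [Function.comp_def] at h'
  unfold flatIntegrand
  exact h'

lemma abs_flatIntegrand_sub_le (hr : 0 ≤ r) {R D : ℝ} {y₁ y₂ : Rd d → ℝ}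
    (h₁ : ∀ u, |y₁ u| ≤ R * decay d r u) (h₂ : ∀ u, |y₂ u| ≤ R * decay d r u)
    (h : ∀ u, |y₁ u - y₂ u| ≤ D * decay d r u) (e s : Rd d) (p : Rd d × (ℝ ∙ e)ᗮ) :
    |flatIntegrand d e y₁ s p - flatIntegrand d e y₂ s p|
      ≤ 3 * R ^ 2 * D * (3 ^ r + 1) * decay d r s * domKernel d r e s p := by
  unfold flatIntegrand domKernel
  rw [← mul_sub, abs_mul, abs_of_nonneg (by positivity : 0 ≤ ‖p.1‖⁻¹)]
  have := mul_le_mul_of_nonneg_left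
    (abs_kinIntegrand_sub_le hr h₁ h₂ h s p.1 (hyperRefl e p.1 p.2))
    (by positivity : 0 ≤ ‖p.1‖⁻¹)
  linarith

lemma abs_flatIntegrand_le (hr : 0 ≤ r) {R : ℝ} {y : Rd d → ℝ}
    (h : ∀ u, |y u| ≤ R * decay d r u) (e s : Rd d) (p : Rd d × (ℝ ∙ e)ᗮ) :
    |flatIntegrand d e y s p|
      ≤ 3 * R ^ 2 * R * (3 ^ r + 1) * decay d r s * domKernel d r e s p := by
  unfold flatIntegrand domKernel
  rw [abs_mul, abs_of_nonneg (by positivity : 0 ≤ ‖p.1‖⁻¹)]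
  have := mul_le_mul_of_nonneg_left (abs_kinIntegrand_le hr h s p.1 (hyperRefl e p.1 p.2))
    (by positivity : 0 ≤ ‖p.1‖⁻¹)
  linarith

lemma integrable_flatIntegrand (hd : 2 ≤ d) (hr : (d : ℝ) < r) {R : ℝ} {y : Rd d → ℝ}
    (hy : Continuous y) (h : ∀ u, |y u| ≤ R * decay d r u) (e s : Rd d) :
    Integrable (flatIntegrand d e y s) (volume.prod volume) := by
  obtain ⟨M, -, hM⟩ := exists_integral_domKernel_le hd hr e
  exact ((hM s).1.const_mul _).mono' (measurable_flatIntegrand hy e s).aestronglyMeasurable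
    (.of_forall fun p => abs_flatIntegrand_le ((Nat.cast_nonneg d).trans hr.le) h e s p)

lemma Kwk_eq (hd : 2 ≤ d) (hr : (d : ℝ) < r) {R : ℝ} {y : Rd d → ℝ}
    (hy : Continuous y) (h : ∀ u, |y u| ≤ R * decay d r u) {e : Rd d} (he : ‖e‖ = 1)
    (s : Rd d) :
    Kwk d y s = 2 * Real.pi * ∫ p, flatIntegrand d e y s p ∂(volume.prod volume) := by
  rw [Kwk, integral_prod _ (integrable_flatIntegrand hd hr hy h e s)]
  congr 1
  refine integral_congr_ae (.of_forall fun x => ?_)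
  rcases eq_or_ne x 0 with rfl | hx
  · simp [flatIntegrand]
  · simp only [flatIntegrand]
    rw [hyperplaneIntegral_eq he hx, integral_const_mul]

lemma exists_norm_eq_one (hd : 2 ≤ d) : ∃ e : Rd d, ‖e‖ = 1 :=
  ⟨EuclideanSpace.single ⟨0, by omega⟩ 1, by simp⟩

lemma continuous_Kwk (hd : 2 ≤ d) (hr : (d : ℝ) < r) {R : ℝ} {y : Rd d → ℝ}
    (hy : Continuous y) (h : ∀ u, |y u| ≤ R * decay d r u) : Continuous (Kwk d y) := by
  have hr0 : 0 ≤ r := (Nat.cast_nonneg d).trans hr.le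
  obtain ⟨e, he⟩ := exists_norm_eq_one hd
  obtain ⟨M, -, hM⟩ := exists_integral_domKernel_le hd hr e
  have hR : 0 ≤ R := nonneg_of_mul_nonneg_left ((abs_nonneg _).trans (h 0)) (decay_pos 0)
  rw [funext (Kwk_eq hd hr hy h he)]
  refine continuous_const.mul (continuous_iff_continuousAt.2 fun s₀ => ?_)
  refine continuousAt_of_dominated
    (bound := fun p => 3 * R ^ 2 * R * (3 ^ r + 1) * (((1 + (‖s₀‖ + 1)) ^ r) ^ 2 *
      domKernel d r e 0 p))
    (.of_forall fun s => (measurable_flatIntegrand hy e s).aestronglyMeasurable)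
    ?_ (((hM 0).1.const_mul _).const_mul _) (.of_forall fun p => ?_)
  · filter_upwards [Metric.ball_mem_nhds s₀ one_pos] with s hs
    have hs' : ‖s‖ ≤ ‖s₀‖ + 1 := by
      have := norm_sub_norm_le s s₀
      rw [← dist_eq_norm] at this
      linarith [Metric.mem_ball.1 hs]
    refine .of_forall fun p => (abs_flatIntegrand_le hr0 h e s p).trans ?_
    have hk : domKernel d r e s p ≤ ((1 + (‖s₀‖ + 1)) ^ r) ^ 2 * domKernel d r e 0 p := by
      have h1 : pairDecay d r s p.1 (hyperRefl e p.1 p.2) ≤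
          ((1 + (‖s₀‖ + 1)) ^ r) ^ 2 * pairDecay d r 0 p.1 (hyperRefl e p.1 p.2) := by
        refine (pairDecay_le hr0 _ _ _).trans ?_
        have := pairDecay_nonneg (r := r) 0 p.1 (hyperRefl e p.1 p.2)
        gcongr
      have := mul_le_mul_of_nonneg_left h1 (by positivity : 0 ≤ ‖p.1‖⁻¹)
      unfold domKernel
      linarith
    have hc : 0 ≤ 3 * R ^ 2 * R * (3 ^ r + 1) := by positivity
    calc 3 * R ^ 2 * R * (3 ^ r + 1) * decay d r s * domKernel d r e s p
        ≤ 3 * R ^ 2 * R * (3 ^ r + 1) * 1 * domKernel d r e s p := by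
          have := domKernel_nonneg (r := r) e s p
          gcongr
          exact decay_le_one hr0 s
      _ ≤ _ := by
          rw [mul_one]
          gcongr
  · unfold flatIntegrand kinIntegrand
    fun_prop

lemma exists_abs_Kwk_sub_le (hd : 2 ≤ d) (hr : (d : ℝ) < r) :
    ∃ L : ℝ, 0 ≤ L ∧ ∀ (R D : ℝ) (y₁ y₂ : Rd d → ℝ), Continuous y₁ → Continuous y₂ →
      (∀ u, |y₁ u| ≤ R * decay d r u) → (∀ u, |y₂ u| ≤ R * decay d r u) →
      (∀ u, |y₁ u - y₂ u| ≤ D * decay d r u) →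
      ∀ s, |Kwk d y₁ s - Kwk d y₂ s| ≤ L * R ^ 2 * D * decay d r s := by
  have hr0 : 0 ≤ r := (Nat.cast_nonneg d).trans hr.le
  obtain ⟨e, he⟩ := exists_norm_eq_one hd
  obtain ⟨M, hM0, hM⟩ := exists_integral_domKernel_le hd hr e
  refine ⟨2 * Real.pi * (3 * (3 ^ r + 1) * M), by positivity,
    fun R D y₁ y₂ hy₁ hy₂ h₁ h₂ h s => ?_⟩
  have hD : 0 ≤ D := nonneg_of_mul_nonneg_left ((abs_nonneg _).trans (h s)) (decay_pos s)
  rw [Kwk_eq hd hr hy₁ h₁ he, Kwk_eq hd hr hy₂ h₂ he, ← mul_sub,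
    ← integral_sub (integrable_flatIntegrand hd hr hy₁ h₁ e s)
      (integrable_flatIntegrand hd hr hy₂ h₂ e s), abs_mul, abs_of_nonneg Real.two_pi_pos.le]
  have hint : |∫ p, (flatIntegrand d e y₁ s p - flatIntegrand d e y₂ s p)
      ∂(volume.prod volume)| ≤ 3 * R ^ 2 * D * (3 ^ r + 1) * decay d r s * M := by
    rw [← Real.norm_eq_abs]
    refine (norm_integral_le_of_norm_le
      ((hM s).1.const_mul (3 * R ^ 2 * D * (3 ^ r + 1) * decay d r s))
      (.of_forall fun p => ?_)).trans ?_
    · exact abs_flatIntegrand_sub_le hr0 h₁ h₂ h e s p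
    rw [integral_const_mul]
    have := decay_nonneg (r := r) s
    exact mul_le_mul_of_nonneg_left (hM s).2 (by positivity)
  calc _ ≤ 2 * Real.pi * (3 * R ^ 2 * D * (3 ^ r + 1) * decay d r s * M) := by gcongr
    _ = _ := by ring

end Collision

open scoped BoundedContinuousFunction

section Duhamel

variable {α : Type*} [TopologicalSpace α]

/-- The integrand of the Duhamel integral with damping rate `c`. -/
def duhamelIntegrand (c : α → ℝ) (h : ℝ →ᵇ (α →ᵇ ℝ)) (τ : ℝ) (s : α) (l : ℝ) : ℝ :=
  Real.exp (-c s * (τ - l)) * h l s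

variable {c : α → ℝ}

lemma continuous_eval_curve (h : ℝ →ᵇ (α →ᵇ ℝ)) (s : α) : Continuous fun l => h l s :=
  (BoundedContinuousFunction.lipschitz_eval_const s).continuous.comp h.continuous

lemma continuous_duhamelIntegrand (h : ℝ →ᵇ (α →ᵇ ℝ)) (τ : ℝ) (s : α) :
    Continuous (duhamelIntegrand c h τ s) := by
  have := continuous_eval_curve h s
  unfold duhamelIntegrand
  fun_prop

lemma abs_eval_curve_le (h : ℝ →ᵇ (α →ᵇ ℝ)) (l : ℝ) (s : α) : |h l s| ≤ ‖h‖ :=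
  ((h l).norm_coe_le_norm s).trans (h.norm_coe_le_norm l)

lemma abs_duhamelIntegrand_le (hc : ∀ s, 1 ≤ c s) (h : ℝ →ᵇ (α →ᵇ ℝ)) {τ l : ℝ} (hl : l ≤ τ)
    (s : α) : |duhamelIntegrand c h τ s l| ≤ ‖h‖ := by
  rw [duhamelIntegrand, abs_mul, Real.abs_exp]
  have h1 : Real.exp (-c s * (τ - l)) ≤ 1 := by
    rw [Real.exp_le_one_iff]
    nlinarith [hc s]
  calc _ ≤ 1 * ‖h‖ := by
        gcongr
        exact abs_eval_curve_le h l s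
    _ = ‖h‖ := one_mul _

lemma integrableOn_duhamelIntegrand (h : ℝ →ᵇ (α →ᵇ ℝ)) (a τ τ' : ℝ) (s : α) :
    IntegrableOn (duhamelIntegrand c h τ s) (Set.Icc a τ') :=
  (continuous_duhamelIntegrand h τ s).integrableOn_Icc

lemma abs_integral_duhamelIntegrand_le (hc : ∀ s, 1 ≤ c s) (h : ℝ →ᵇ (α →ᵇ ℝ)) (a τ : ℝ)
    (s : α) : |∫ l in Set.Icc a τ, duhamelIntegrand c h τ s l| ≤ ‖h‖ / c s := by
  have hcs : 0 < c s := zero_lt_one.trans_le (hc s)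
  have hexp : ∀ l, ‖h‖ * Real.exp (-c s * (τ - l))
      = ‖h‖ * Real.exp (-c s * τ) * Real.exp (c s * l) := fun l => by
    rw [mul_assoc, ← Real.exp_add]
    ring_nf
  have hint : IntegrableOn (fun l => ‖h‖ * Real.exp (-c s * (τ - l))) (Set.Iic τ) := by
    simp_rw [hexp]
    exact (integrableOn_exp_mul_Iic hcs τ).const_mul _
  have hsub : Set.Icc a τ ⊆ Set.Iic τ := Set.Icc_subset_Iic_self
  rw [← Real.norm_eq_abs]
  calc _ ≤ ∫ l in Set.Icc a τ, ‖h‖ * Real.exp (-c s * (τ - l)) := by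
        refine norm_integral_le_of_norm_le (hint.mono_set hsub) (.of_forall fun l => ?_)
        rw [duhamelIntegrand, norm_mul, Real.norm_eq_abs, Real.abs_exp, mul_comm]
        gcongr
        exact abs_eval_curve_le h l s
    _ ≤ ∫ l in Set.Iic τ, ‖h‖ * Real.exp (-c s * (τ - l)) :=
        setIntegral_mono_set hint (.of_forall fun l => by positivity) hsub.eventuallyLE
    _ = ‖h‖ / c s := by
        simp_rw [hexp]
        rw [integral_const_mul, integral_exp_mul_Iic hcs, mul_div_assoc', mul_assoc,
          ← Real.exp_add]
        simp

lemma abs_integral_duhamelIntegrand_sub_le (hc : ∀ s, 1 ≤ c s) (h : ℝ →ᵇ (α →ᵇ ℝ)) (a : ℝ)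
    {τ τ' : ℝ} (hτ : τ ≤ τ') (s : α) :
    |(∫ l in Set.Icc a τ', duhamelIntegrand c h τ' s l)
      - ∫ l in Set.Icc a τ, duhamelIntegrand c h τ s l| ≤ 2 * ‖h‖ * (τ' - τ) := by
  have hcs : 0 < c s := zero_lt_one.trans_le (hc s)
  set I := ∫ l in Set.Icc a τ, duhamelIntegrand c h τ s l with hI
  have hsplit : Set.Icc a τ' = Set.Icc a τ ∪ Set.Ioc τ τ' ∩ Set.Ici a := by
    ext l
    simp only [Set.mem_Icc, Set.mem_union, Set.mem_inter_iff, Set.mem_Ioc, Set.mem_Ici]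
    constructor
    · rintro ⟨h1, h2⟩
      rcases le_or_gt l τ with h3 | h3
      exacts [.inl ⟨h1, h3⟩, .inr ⟨⟨h3, h2⟩, h1⟩]
    · rintro (⟨h1, h2⟩ | ⟨⟨h1, h2⟩, h3⟩)
      exacts [⟨h1, h2.trans hτ⟩, ⟨h3, h2⟩]
  have hdisj : Disjoint (Set.Icc a τ) (Set.Ioc τ τ' ∩ Set.Ici a) :=
    Set.disjoint_left.2 fun l h1 h2 => (h2.1.1.trans_le h1.2).false
  have hfirst : ∫ l in Set.Icc a τ, duhamelIntegrand c h τ' s l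
      = Real.exp (-c s * (τ' - τ)) * I := by
    rw [hI, ← integral_const_mul]
    refine integral_congr_ae (.of_forall fun l => ?_)
    simp only [duhamelIntegrand]
    rw [← mul_assoc, ← Real.exp_add]
    ring_nf
  have hint : IntegrableOn (duhamelIntegrand c h τ' s) (Set.Ioc τ τ' ∩ Set.Ici a) :=
    ((continuous_duhamelIntegrand h τ' s).integrableOn_Icc (a := τ) (b := τ')).mono_set
      (Set.inter_subset_left.trans Set.Ioc_subset_Icc_self)
  have hsecond : |∫ l in Set.Ioc τ τ' ∩ Set.Ici a, duhamelIntegrand c h τ' s l|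
      ≤ ‖h‖ * (τ' - τ) := by
    have hvol : volume.real (Set.Ioc τ τ' ∩ Set.Ici a) ≤ τ' - τ := by
      calc _ ≤ volume.real (Set.Ioc τ τ') :=
            measureReal_mono Set.inter_subset_left (by simp)
        _ = τ' - τ := by rw [Real.volume_real_Ioc_of_le hτ]
    refine (norm_setIntegral_le_of_norm_le_const (C := ‖h‖)
      ((measure_mono Set.inter_subset_left).trans_lt (by simp : volume (Set.Ioc τ τ') < ⊤))
      fun l hl => (Real.norm_eq_abs _).trans_le
        (abs_duhamelIntegrand_le hc h hl.1.2 s)).trans ?_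
    gcongr
  rw [hsplit, setIntegral_union hdisj (measurableSet_Ioc.inter measurableSet_Ici)
    (integrableOn_duhamelIntegrand h a τ' τ s) hint, hfirst]
  have h1 : 1 - c s * (τ' - τ) ≤ Real.exp (-c s * (τ' - τ)) := by
    have := Real.add_one_le_exp (-c s * (τ' - τ))
    linarith
  have h2 : Real.exp (-c s * (τ' - τ)) ≤ 1 := by
    rw [Real.exp_le_one_iff]
    nlinarith
  have h3 : |(1 - Real.exp (-c s * (τ' - τ))) * I| ≤ ‖h‖ * (τ' - τ) := by
    rw [abs_mul, abs_of_nonneg (by linarith)]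
    calc _ ≤ (c s * (τ' - τ)) * (‖h‖ / c s) :=
          mul_le_mul (by linarith) (abs_integral_duhamelIntegrand_le hc h a τ s) (abs_nonneg _)
            (mul_nonneg hcs.le (by linarith))
      _ = ‖h‖ * (τ' - τ) := by field_simp
  have h4 := abs_le.1 h3
  have h5 := abs_le.1 hsecond
  exact abs_le.2 ⟨by linarith [h4.2, h5.1], by linarith [h4.1, h5.2]⟩

lemma continuous_integral_duhamelIntegrand [FirstCountableTopology α] (hc : ∀ s, 1 ≤ c s)
    (hcc : Continuous c) (h : ℝ →ᵇ (α →ᵇ ℝ)) (a τ : ℝ) :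
    Continuous fun s => ∫ l in Set.Icc a τ, duhamelIntegrand c h τ s l := by
  refine continuous_of_dominated (bound := fun _ => ‖h‖)
    (fun s => (continuous_duhamelIntegrand h τ s).aestronglyMeasurable)
    (fun s => (ae_restrict_iff' measurableSet_Icc).2
      (.of_forall fun l hl => abs_duhamelIntegrand_le hc h hl.2 s))
    (by simp) (.of_forall fun l => ?_)
  have := (h l).continuous
  unfold duhamelIntegrand
  fun_prop

/-- The Duhamel operator acts boundedly on bounded continuous curves. -/
lemma exists_duhamel [FirstCountableTopology α] (hc : ∀ s, 1 ≤ c s) (hcc : Continuous c)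
    (a : ℝ) : ∃ S : (ℝ →ᵇ (α →ᵇ ℝ)) → (ℝ →ᵇ (α →ᵇ ℝ)),
      (∀ h τ s, S h τ s = ∫ l in Set.Icc a τ, duhamelIntegrand c h τ s l) ∧
      (∀ h, ‖S h‖ ≤ ‖h‖) ∧ ∀ h g, S h - S g = S (h - g) := by
  have hle : ∀ (h : ℝ →ᵇ (α →ᵇ ℝ)) τ s,
      |∫ l in Set.Icc a τ, duhamelIntegrand c h τ s l| ≤ ‖h‖ := fun h τ s =>
    (abs_integral_duhamelIntegrand_le hc h a τ s).trans (div_le_self (norm_nonneg h) (hc s))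
  let S₀ : (ℝ →ᵇ (α →ᵇ ℝ)) → ℝ → (α →ᵇ ℝ) := fun h τ =>
    BoundedContinuousFunction.ofNormedAddCommGroup
      (fun s => ∫ l in Set.Icc a τ, duhamelIntegrand c h τ s l)
      (continuous_integral_duhamelIntegrand hc hcc h a τ) ‖h‖ (hle h τ)
  have hS₀ : ∀ h, Continuous (S₀ h) := fun h => by
    have hlip : ∀ τ τ', τ ≤ τ' → dist (S₀ h τ') (S₀ h τ) ≤ 2 * ‖h‖ * (τ' - τ) := fun τ τ' hτ =>
      (BoundedContinuousFunction.dist_le (by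
        have := sub_nonneg.2 hτ
        positivity)).2 fun s => abs_integral_duhamelIntegrand_sub_le hc h a hτ s
    refine (LipschitzWith.of_dist_le_mul (K := ⟨2 * ‖h‖, by positivity⟩) fun τ τ' => ?_).continuous
    rcases le_total τ τ' with hτ | hτ
    · rw [dist_comm, dist_comm τ, Real.dist_eq, abs_of_nonneg (sub_nonneg.2 hτ)]
      exact hlip τ τ' hτ
    · rw [Real.dist_eq, abs_of_nonneg (sub_nonneg.2 hτ)]
      exact hlip τ' τ hτ
  refine ⟨fun h => BoundedContinuousFunction.ofNormedAddCommGroup (S₀ h) (hS₀ h) ‖h‖ fun τ =>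
      BoundedContinuousFunction.norm_ofNormedAddCommGroup_le _ (norm_nonneg h) (hle h τ),
    fun _ _ _ => rfl,
    fun h => BoundedContinuousFunction.norm_ofNormedAddCommGroup_le _ (norm_nonneg h) _,
    fun h g => ?_⟩
  ext τ s
  change (∫ l in Set.Icc a τ, duhamelIntegrand c h τ s l)
    - (∫ l in Set.Icc a τ, duhamelIntegrand c g τ s l)
    = ∫ l in Set.Icc a τ, duhamelIntegrand c (h - g) τ s l
  rw [← integral_sub (integrableOn_duhamelIntegrand h a τ τ s)
    (integrableOn_duhamelIntegrand g a τ τ s)]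
  refine integral_congr_ae (.of_forall fun l => ?_)
  simp [duhamelIntegrand, mul_sub]

/-- A Grönwall-type uniqueness principle: a bounded curve dominated by the time integrals of
its own bounds vanishes. -/
lemma eq_zero_of_integral_bound {u : ℝ → ℝ} {a Q k : ℝ} (hu0 : ∀ τ, a ≤ τ → 0 ≤ u τ)
    (huQ : ∀ τ, a ≤ τ → u τ ≤ Q)
    (hstep : ∀ v : ℝ → ℝ, Continuous v → (∀ τ, a ≤ τ → u τ ≤ v τ) →
      ∀ τ, a ≤ τ → u τ ≤ k * ∫ l in a..τ, v l) :
    ∀ τ, a ≤ τ → u τ = 0 := by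
  have hn : ∀ n : ℕ, ∀ τ, a ≤ τ → u τ ≤ Q * ((k * (τ - a)) ^ n / n.factorial) := by
    intro n
    induction n with
    | zero => simpa using huQ
    | succ n ih =>
      intro τ hτ
      refine (hstep _ (by fun_prop) ih τ hτ).trans_eq ?_
      simp_rw [mul_pow]
      rw [intervalIntegral.integral_const_mul, intervalIntegral.integral_div,
        intervalIntegral.integral_const_mul,
        intervalIntegral.integral_comp_sub_right (fun l => l ^ n), integral_pow,
        Nat.factorial_succ]
      push_cast
      have := Nat.factorial_ne_zero n
      field_simp
      simp only [sub_self]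
      ring
  intro τ hτ
  have hlim : Filter.Tendsto (fun n : ℕ => Q * ((k * (τ - a)) ^ n / n.factorial)) Filter.atTop
      (nhds 0) := by
    simpa using (FloorSemiring.tendsto_pow_div_factorial_atTop (k * (τ - a))).const_mul Q
  exact le_antisymm (ge_of_tendsto' hlim fun n => hn n τ hτ) (hu0 τ hτ)

end Duhamel

section WeightedSpace

variable {d : ℕ} {r : ℝ}

/-- The function of `C_r` whose weighted version is `f`. -/
def unweight (r : ℝ) (f : Rd d →ᵇ ℝ) (s : Rd d) : ℝ := decay d r s * f s

lemma continuous_unweight (f : Rd d →ᵇ ℝ) : Continuous (unweight r f) :=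
  continuous_decay.mul f.continuous

lemma abs_unweight_le (f : Rd d →ᵇ ℝ) (u : Rd d) : |unweight r f u| ≤ ‖f‖ * decay d r u := by
  rw [unweight, abs_mul, abs_of_nonneg (decay_nonneg u), mul_comm]
  exact mul_le_mul_of_nonneg_right (f.norm_coe_le_norm u) (decay_nonneg u)

lemma unweight_sub (f g : Rd d →ᵇ ℝ) (u : Rd d) :
    unweight r f u - unweight r g u = unweight r (f - g) u := by
  simp [unweight, mul_sub]

lemma rpow_mul_abs_unweight (f : Rd d →ᵇ ℝ) (s : Rd d) :
    (1 + ‖s‖) ^ r * |unweight r f s| = |f s| := by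
  rw [unweight, abs_mul, abs_of_nonneg (decay_nonneg s), ← mul_assoc, rpow_mul_decay, one_mul]

lemma memCr_unweight (f : Rd d →ᵇ ℝ) : memCr d r (unweight r f) :=
  ⟨continuous_unweight f, ‖f‖, fun s => by
    rw [rpow_mul_abs_unweight]
    exact f.norm_coe_le_norm s⟩

lemma wNorm_unweight_le (f : Rd d →ᵇ ℝ) : wNorm d r (unweight r f) ≤ ‖f‖ := by
  refine ciSup_le fun s => ?_
  rw [rpow_mul_abs_unweight]
  exact f.norm_coe_le_norm s

lemma continuous_weight : Continuous fun s : Rd d => (1 + ‖s‖) ^ r :=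
  (continuous_const.add continuous_norm).rpow_const fun u =>
    Or.inl (add_pos_of_pos_of_nonneg one_pos (norm_nonneg u)).ne'

lemma memCr.rpow_mul_abs_le {y : Rd d → ℝ} (hy : memCr d r y) (s : Rd d) :
    (1 + ‖s‖) ^ r * |y s| ≤ wNorm d r y := by
  obtain ⟨K, hK⟩ := hy.2
  exact le_ciSup (f := fun s : Rd d => (1 + ‖s‖) ^ r * |y s|)
    ⟨K, by rintro _ ⟨s, rfl⟩; exact hK s⟩ s

/-- The weighted version of a function of `C_r`. -/
def weighted (y : Rd d → ℝ) (hy : memCr d r y) : Rd d →ᵇ ℝ :=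
  BoundedContinuousFunction.ofNormedAddCommGroup (fun s => (1 + ‖s‖) ^ r * y s)
    (continuous_weight.mul hy.1) (wNorm d r y) fun s => by
      rw [norm_mul, Real.norm_eq_abs, abs_of_nonneg (by positivity)]
      exact hy.rpow_mul_abs_le s

lemma weighted_apply (y : Rd d → ℝ) (hy : memCr d r y) (s : Rd d) :
    weighted y hy s = (1 + ‖s‖) ^ r * y s := rfl

lemma unweight_weighted (y : Rd d → ℝ) (hy : memCr d r y) : unweight r (weighted y hy) = y := by
  ext s
  rw [unweight, weighted_apply, ← mul_assoc, mul_comm (decay d r s), rpow_mul_decay, one_mul]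

lemma memCr.sub {y y' : Rd d → ℝ} (hy : memCr d r y) (hy' : memCr d r y') :
    memCr d r fun s => y s - y' s := by
  rw [← unweight_weighted y hy, ← unweight_weighted y' hy']
  simp_rw [unweight_sub]
  exact memCr_unweight _

lemma wNorm_nonneg (y : Rd d → ℝ) : 0 ≤ wNorm d r y :=
  Real.iSup_nonneg fun _ => by positivity

lemma norm_weighted_le (y : Rd d → ℝ) (hy : memCr d r y) : ‖weighted y hy‖ ≤ wNorm d r y :=
  BoundedContinuousFunction.norm_ofNormedAddCommGroup_le _ (wNorm_nonneg y) _

lemma dist_weighted_le (y y' : Rd d → ℝ) (hy : memCr d r y) (hy' : memCr d r y') :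
    dist (weighted y hy) (weighted y' hy') ≤ wNorm d r fun s => y s - y' s := by
  refine (BoundedContinuousFunction.dist_le (wNorm_nonneg _)).2 fun s => ?_
  rw [Real.dist_eq, weighted_apply, weighted_apply, ← mul_sub, abs_mul,
    abs_of_nonneg (by positivity)]
  exact (hy.sub hy').rpow_mul_abs_le s

/-- The wave kinetic integral as a locally Lipschitz map of the weighted space. -/
lemma exists_collision (hd : 2 ≤ d) (hr : (d : ℝ) < r) :
    ∃ A : (Rd d →ᵇ ℝ) → (Rd d →ᵇ ℝ), ∃ L : ℝ, 0 ≤ L ∧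
      (∀ f s, A f s = (1 + ‖s‖) ^ r * Kwk d (unweight r f) s) ∧ A 0 = 0 ∧
      ∀ R f g, ‖f‖ ≤ R → ‖g‖ ≤ R → ‖A f - A g‖ ≤ L * R ^ 2 * ‖f - g‖ := by
  obtain ⟨L, hL, hLip⟩ := exists_abs_Kwk_sub_le (d := d) hd hr
  have hbd : ∀ {R : ℝ} {f : Rd d →ᵇ ℝ}, ‖f‖ ≤ R → ∀ u, |unweight r f u| ≤ R * decay d r u :=
    fun hf u => (abs_unweight_le _ u).trans (mul_le_mul_of_nonneg_right hf (decay_nonneg u))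
  have hsub : ∀ R (f g : Rd d →ᵇ ℝ), ‖f‖ ≤ R → ‖g‖ ≤ R → ∀ s,
      |(1 + ‖s‖) ^ r * Kwk d (unweight r f) s - (1 + ‖s‖) ^ r * Kwk d (unweight r g) s|
        ≤ L * R ^ 2 * ‖f - g‖ := fun R f g hf hg s => by
    have h1 := hLip R ‖f - g‖ _ _ (continuous_unweight f) (continuous_unweight g) (hbd hf)
      (hbd hg) (fun u => by rw [unweight_sub]; exact abs_unweight_le _ u) s
    rw [← mul_sub, abs_mul, abs_of_nonneg (by positivity)]
    calc _ ≤ (1 + ‖s‖) ^ r * (L * R ^ 2 * ‖f - g‖ * decay d r s) := by gcongr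
      _ = L * R ^ 2 * ‖f - g‖ * ((1 + ‖s‖) ^ r * decay d r s) := by ring
      _ = _ := by rw [rpow_mul_decay, mul_one]
  have hK0 : ∀ s, Kwk d (unweight r (0 : Rd d →ᵇ ℝ)) s = 0 := fun s => by
    simp [Kwk, hyperplaneIntegral, kinIntegrand, unweight]
  let A : (Rd d →ᵇ ℝ) → (Rd d →ᵇ ℝ) := fun f =>
    BoundedContinuousFunction.ofNormedAddCommGroup
      (fun s => (1 + ‖s‖) ^ r * Kwk d (unweight r f) s)
      (continuous_weight.mul (continuous_Kwk hd hr (continuous_unweight f) (abs_unweight_le f)))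
      (L * ‖f‖ ^ 2 * ‖f - 0‖) fun s => by
        simpa only [hK0, mul_zero, sub_zero, Real.norm_eq_abs] using
          hsub ‖f‖ f 0 le_rfl (by simp) s
  refine ⟨A, L, hL, fun _ _ => rfl, ?_, fun R f g hf hg => ?_⟩
  · ext s
    change (1 + ‖s‖) ^ r * Kwk d (unweight r 0) s = 0
    rw [hK0, mul_zero]
  · exact (BoundedContinuousFunction.norm_le (by positivity)).2 fun s => hsub R f g hf hg s

/-- A locally Lipschitz map acts on bounded continuous curves by composition. -/
lemma exists_curve_map {E : Type*} [NormedAddCommGroup E] (A : E → E) {L : ℝ} (hL : 0 ≤ L)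
    (hA0 : A 0 = 0)
    (hA : ∀ R f g, ‖f‖ ≤ R → ‖g‖ ≤ R → ‖A f - A g‖ ≤ L * R ^ 2 * ‖f - g‖) :
    ∃ N : (ℝ →ᵇ E) → (ℝ →ᵇ E), (∀ f l, N f l = A (f l)) ∧
      (∀ R f, ‖f‖ ≤ R → ‖N f‖ ≤ L * R ^ 2 * R) ∧
      ∀ R f g, ‖f‖ ≤ R → ‖g‖ ≤ R → ‖N f - N g‖ ≤ L * R ^ 2 * ‖f - g‖ := by
  have hle : ∀ (R : ℝ) (f : ℝ →ᵇ E), ‖f‖ ≤ R → ∀ l, ‖A (f l)‖ ≤ L * R ^ 2 * R := fun R f hf l => by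
    have hfl := (f.norm_coe_le_norm l).trans hf
    have h1 := hA R (f l) 0 hfl (by simpa using (norm_nonneg _).trans hfl)
    rw [hA0, sub_zero, sub_zero] at h1
    exact h1.trans (by gcongr)
  have hcont : ∀ f : ℝ →ᵇ E, Continuous fun l => A (f l) := fun f => by
    refine continuous_iff_continuousAt.2 fun l₀ => tendsto_iff_norm_sub_tendsto_zero.2 ?_
    refine squeeze_zero (fun _ => norm_nonneg _) (fun l => hA ‖f‖ (f l) (f l₀)
      (f.norm_coe_le_norm l) (f.norm_coe_le_norm l₀)) ?_
    have := (tendsto_iff_norm_sub_tendsto_zero.1 (f.continuous.tendsto l₀)).const_mul (L * ‖f‖ ^ 2)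
    simpa using this
  refine ⟨fun f => BoundedContinuousFunction.ofNormedAddCommGroup (fun l => A (f l)) (hcont f)
    (L * ‖f‖ ^ 2 * ‖f‖) (hle ‖f‖ f le_rfl), fun _ _ => rfl, fun R f hf => ?_,
    fun R f g hf hg => ?_⟩
  · have hR : 0 ≤ R := (norm_nonneg f).trans hf
    exact BoundedContinuousFunction.norm_ofNormedAddCommGroup_le _ (by positivity) (hle R f hf)
  · refine (BoundedContinuousFunction.norm_le (by positivity)).2 fun l => ?_
    refine (hA R (f l) (g l) ((f.norm_coe_le_norm l).trans hf)
      ((g.norm_coe_le_norm l).trans hg)).trans ?_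
    gcongr
    exact (f - g).norm_coe_le_norm l

lemma memCr_two_mul_sq (b : SchwartzMap (Rd d) ℝ) : memCr d r fun s => 2 * b s ^ 2 := by
  obtain ⟨k, hk⟩ := exists_nat_ge r
  have hb := fun (j : ℕ) (hj : j ≤ k) (s : Rd d) =>
    SchwartzMap.one_add_le_sup_seminorm_apply (𝕜 := ℝ) (m := (k, 0)) hj le_rfl b s
  simp only [norm_iteratedFDeriv_zero] at hb
  set P := 2 ^ k * ((Finset.Iic (k, 0)).sup fun m => SchwartzMap.seminorm ℝ m.1 m.2) b
  refine ⟨by fun_prop, 2 * (P * P), fun s => ?_⟩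
  have h1 : (1 + ‖s‖) ^ r * |b s| ≤ P := by
    refine le_trans ?_ (hb k le_rfl s)
    rw [Real.norm_eq_abs, ← Real.rpow_natCast]
    gcongr
    linarith [norm_nonneg s]
  have h2 : |b s| ≤ P := by simpa using hb 0 (Nat.zero_le k) s
  have h3 : 0 ≤ P := (abs_nonneg _).trans h2
  rw [abs_mul, abs_two, abs_pow]
  calc _ = 2 * (((1 + ‖s‖) ^ r * |b s|) * |b s|) := by ring
    _ ≤ 2 * (P * P) := by gcongr

end WeightedSpace

section FixedPoint

variable {d : ℕ} {r : ℝ}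

lemma exists_fixedPoint_closedBall {X : Type*} [NormedAddCommGroup X] [CompleteSpace X]
    {C : ℝ} (hC : 0 ≤ C) (Φ : X → X) (hmap : ∀ f, ‖f‖ ≤ C → ‖Φ f‖ ≤ C)
    (hcontr : ∀ f g, ‖f‖ ≤ C → ‖g‖ ≤ C → ‖Φ f - Φ g‖ ≤ 1 / 2 * ‖f - g‖) :
    ∃ f, ‖f‖ ≤ C ∧ Φ f = f := by
  have hmaps : Set.MapsTo Φ (Metric.closedBall 0 C) (Metric.closedBall 0 C) := fun f hf => by
    rw [mem_closedBall_zero_iff] at hf ⊢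
    exact hmap f hf
  have hk : ContractingWith (1 / 2) (hmaps.restrict Φ _ _) := by
    refine ⟨by norm_num [← NNReal.coe_lt_coe], LipschitzWith.of_dist_le_mul fun f g => ?_⟩
    rw [Subtype.dist_eq, Subtype.dist_eq, dist_eq_norm, dist_eq_norm]
    simpa using hcontr f g (mem_closedBall_zero_iff.1 f.2) (mem_closedBall_zero_iff.1 g.2)
  obtain ⟨f, hf, hfix, -⟩ := hk.exists_fixedPoint' Metric.isClosed_closedBall.isComplete hmaps
    (Metric.mem_closedBall_self hC) (edist_ne_top _ _)
  exact ⟨f, mem_closedBall_zero_iff.1 hf, hfix⟩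

lemma continuous_gam (rstar : ℝ) : Continuous (gam d rstar) := by
  unfold gam
  exact (by fun_prop : Continuous fun s : Rd d => 1 + ‖s‖ ^ 2).rpow_const fun s =>
    Or.inl (by positivity)

lemma one_le_gam {rstar : ℝ} (hrstar : 0 ≤ rstar) (s : Rd d) : 1 ≤ gam d rstar s :=
  Real.one_le_rpow (by nlinarith [sq_nonneg ‖s‖]) hrstar

lemma integral_duhamelIntegrand_eq {rstar τ a ε : ℝ} {b : Rd d → ℝ} {y : ℝ → Rd d → ℝ}
    {h : ℝ →ᵇ (Rd d →ᵇ ℝ)} {s : Rd d}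
    (hh : ∀ l ∈ Set.Icc a τ,
      h l s = (1 + ‖s‖) ^ r * (2 * b s ^ 2) + ε * ((1 + ‖s‖) ^ r * Kwk d (y l) s)) :
    ∫ l in Set.Icc a τ, duhamelIntegrand (fun s => 2 * gam d rstar s) h τ s l
      = (1 + ‖s‖) ^ r * ∫ l in Set.Icc a τ,
        Real.exp (-2 * gam d rstar s * (τ - l)) * (2 * (b s) ^ 2 + ε * Kwk d (y l) s) := by
  rw [← integral_const_mul]
  refine setIntegral_congr_fun measurableSet_Icc fun l hl => ?_
  simp only [duhamelIntegrand]
  rw [hh l hl]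
  ring_nf

/-- Two bounded curves satisfying the same mild equation on `[a, ∞)` coincide there. -/
lemma eq_of_duhamel_eq {α : Type*} [TopologicalSpace α] {c : α → ℝ} (hc : ∀ s, 1 ≤ c s) {a k : ℝ}
    {f g F G : ℝ →ᵇ (α →ᵇ ℝ)}
    (hf : ∀ τ, a ≤ τ → ∀ s, f τ s = ∫ l in Set.Icc a τ, duhamelIntegrand c F τ s l)
    (hg : ∀ τ, a ≤ τ → ∀ s, g τ s = ∫ l in Set.Icc a τ, duhamelIntegrand c G τ s l)
    (hFG : ∀ l, ‖F l - G l‖ ≤ k * ‖f l - g l‖) (hk : 0 ≤ k) :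
    ∀ τ, a ≤ τ → f τ = g τ := by
  have hzero := eq_zero_of_integral_bound (u := fun τ => ‖f τ - g τ‖) (a := a) (Q := ‖f - g‖)
    (k := k) (fun τ _ => norm_nonneg _) (fun τ _ => (f - g).norm_coe_le_norm τ)
    fun v hv huv τ hτ => ?_
  · intro τ hτ
    exact sub_eq_zero.1 (norm_eq_zero.1 (hzero τ hτ))
  · have hv0 : ∀ l ∈ Set.Icc a τ, 0 ≤ v l := fun l hl => (norm_nonneg _).trans (huv l hl.1)
    rw [intervalIntegral.integral_of_le hτ, ← integral_Icc_eq_integral_Ioc]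
    refine (BoundedContinuousFunction.norm_le (mul_nonneg hk
      (setIntegral_nonneg measurableSet_Icc hv0))).2 fun s => ?_
    rw [BoundedContinuousFunction.sub_apply, hf τ hτ, hg τ hτ,
      ← integral_sub (integrableOn_duhamelIntegrand F a τ τ s)
        (integrableOn_duhamelIntegrand G a τ τ s), ← integral_const_mul]
    refine norm_integral_le_of_norm_le (hv.integrableOn_Icc.const_mul k)
      ((ae_restrict_iff' measurableSet_Icc).2 (.of_forall fun l hl => ?_))
    have hexp : Real.exp (-c s * (τ - l)) ≤ 1 := by
      rw [Real.exp_le_one_iff]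
      nlinarith [hc s, hl.2]
    have hFs : |F l s - G l s| ≤ k * v l :=
      ((F l - G l).norm_coe_le_norm s).trans ((hFG l).trans
        (mul_le_mul_of_nonneg_left (huv l hl.1) hk))
    rw [duhamelIntegrand, duhamelIntegrand, ← mul_sub, norm_mul, Real.norm_eq_abs, Real.abs_exp,
      Real.norm_eq_abs]
    calc _ ≤ 1 * (k * v l) := by gcongr
      _ = k * v l := one_mul _

end FixedPoint

lemma norm_add_smul_sub_add_smul {E : Type*} [NormedAddCommGroup E] [NormedSpace ℝ E] (u v w : E)
    {ε : ℝ} (hε : 0 ≤ ε) : ‖(u + ε • v) - (u + ε • w)‖ = ε * ‖v - w‖ := by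
  rw [add_sub_add_left_eq_sub, ← smul_sub, norm_smul, Real.norm_eq_abs, abs_of_nonneg hε]

/-- For `d ≥ 2`, `r > d` there exist `ε_* > 0` and `C > 0`, independent of
`T`, such that for every `ε ∈ [0, ε_*]` and every `T ∈ (0,∞)` the damped/driven wave kinetic
equation with zero data at `τ = −T` has a solution `m*` with `sup_{τ≥−T} ‖m*(τ)‖_r ≤ C`,
unique among all bounded continuous curves `[−T,∞) → C_r(ℝ^d)` solving the equation. -/
theorem statement7 (d : ℕ) (hd : 2 ≤ d) (r : ℝ) (hr : (d : ℝ) < r)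
    (rstar : ℝ) (hrstar : 0 < rstar)
    (b : SchwartzMap (Rd d) ℝ) (hb : ∀ s, 0 < b s) :
    ∃ εstar : ℝ, 0 < εstar ∧ ∃ C : ℝ, 0 < C ∧
      ∀ ε ∈ Set.Icc (0 : ℝ) εstar, ∀ T : ℝ, 0 < T →
        ∃ m : ℝ → Rd d → ℝ, IsWKESol d r rstar (⇑b) T ε m ∧
          (∀ τ ∈ Set.Ici (-T), wNorm d r (m τ) ≤ C) ∧
          (∀ m' : ℝ → Rd d → ℝ, IsWKESol d r rstar (⇑b) T ε m' →
            ∀ τ ∈ Set.Ici (-T), ∀ s : Rd d, m' τ s = m τ s) := by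
  obtain ⟨A, L, hL, hAK, hA0, hA⟩ := exists_collision hd hr
  obtain ⟨N, hN, hNle, hNsub⟩ := exists_curve_map A hL hA0 hA
  set B := weighted _ (memCr_two_mul_sq (r := r) b)
  set C := ‖B‖ + 1
  have hB0 : 0 ≤ ‖B‖ := norm_nonneg B
  have hC1 : 1 ≤ C := by linarith
  have hLC : 0 ≤ L * C ^ 2 := by positivity
  refine ⟨1 / (2 * (L * C ^ 2 * C + 1)), by positivity, C, by positivity, fun ε hε T hT => ?_⟩
  have hε0 : 0 ≤ ε := hε.1
  have hε1 : ε * (L * C ^ 2 * C) ≤ 1 / 2 := by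
    have := (le_div_iff₀ (by positivity)).1 hε.2
    linarith
  have hε2 : ε * (L * C ^ 2) ≤ 1 / 2 :=
    (mul_le_mul_of_nonneg_left (le_mul_of_one_le_right hLC hC1) hε0).trans hε1
  have hc1 : ∀ s, 1 ≤ 2 * gam d rstar s := fun s => by
    linarith [one_le_gam hrstar.le s]
  obtain ⟨S, hS, hSle, hSsub⟩ := exists_duhamel hc1 (continuous_const.mul (continuous_gam rstar))
    (-T)
  let src : (ℝ →ᵇ (Rd d →ᵇ ℝ)) → (ℝ →ᵇ (Rd d →ᵇ ℝ)) := fun f =>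
    BoundedContinuousFunction.const ℝ B + ε • N f
  have hsrc : ∀ f l s, src f l s = (1 + ‖s‖) ^ r * (2 * b s ^ 2)
      + ε * ((1 + ‖s‖) ^ r * Kwk d (unweight r (f l)) s) := fun f l s => by
    change B s + ε * (N f l s) = _
    rw [hN, hAK]
    rfl
  obtain ⟨f, hfC, hfix⟩ := exists_fixedPoint_closedBall (zero_le_one.trans hC1)
    (fun f => S (src f))
    (fun f hf => by
      refine (hSle _).trans ?_
      have h0 : ‖src f‖ ≤ ‖BoundedContinuousFunction.const ℝ B‖ + ‖ε • N f‖ :=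
        norm_add_le (BoundedContinuousFunction.const ℝ B) (ε • N f)
      have h1 : ‖BoundedContinuousFunction.const ℝ B‖ ≤ ‖B‖ :=
        BoundedContinuousFunction.norm_const_le B
      have h2 : ‖ε • N f‖ ≤ ε * (L * C ^ 2 * C) := by
        rw [norm_smul, Real.norm_eq_abs, abs_of_nonneg hε0]
        exact mul_le_mul_of_nonneg_left (hNle C f hf) hε0
      linarith)
    (fun f g hf hg => by
      change ‖S (src f) - S (src g)‖ ≤ _
      rw [hSsub]
      have h0 : ‖src f - src g‖ = ε * ‖N f - N g‖ :=
        norm_add_smul_sub_add_smul (BoundedContinuousFunction.const ℝ B) (N f) (N g) hε0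
      calc _ ≤ ‖src f - src g‖ := hSle _
        _ = ε * ‖N f - N g‖ := h0
        _ ≤ ε * (L * C ^ 2 * ‖f - g‖) := by
            gcongr
            exact hNsub C f g hf hg
        _ = ε * (L * C ^ 2) * ‖f - g‖ := by ring
        _ ≤ _ := by gcongr)
  have hmild : ∀ τ s, f τ s
      = ∫ l in Set.Icc (-T) τ, duhamelIntegrand (fun s => 2 * gam d rstar s) (src f) τ s l :=
    fun τ s => by
      conv_lhs => rw [← hfix]
      exact hS _ τ s
  have hle : ∀ τ, wNorm d r (unweight r (f τ)) ≤ C := fun τ =>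
    (wNorm_unweight_le _).trans ((f.norm_coe_le_norm τ).trans hfC)
  refine ⟨fun τ => unweight r (f τ), ⟨fun τ _ => memCr_unweight _, ⟨C, fun τ _ => hle τ⟩,
    fun τ₀ _ δ hδ => ?_, fun τ _ s => ?_⟩, fun τ _ => hle τ, fun m' hm' τ hτ s => ?_⟩
  · obtain ⟨η, hη, h⟩ := Metric.continuous_iff.1 f.continuous τ₀ δ hδ
    refine ⟨η, hη, fun τ _ hτ => ?_⟩
    simp_rw [unweight_sub]
    exact (wNorm_unweight_le _).trans_lt (by simpa [dist_eq_norm] using h τ hτ)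
  · change decay d r s * f τ s = _
    rw [hmild τ s, integral_duhamelIntegrand_eq (r := r) (b := b)
      (y := fun l => unweight r (f l)) (ε := ε) fun l _ => hsrc f l s, ← mul_assoc,
      mul_comm (decay d r s), rpow_mul_decay, one_mul]
  · obtain ⟨hmem, ⟨K, hK⟩, hcont, heq⟩ := hm'
    have hmax : ∀ τ, max τ (-T) ∈ Set.Ici (-T) := fun τ => Set.mem_Ici.2 (le_max_right _ _)
    let g₀ : ℝ → (Rd d →ᵇ ℝ) := fun τ => weighted (m' (max τ (-T))) (hmem _ (hmax τ))
    have hg₀ : Continuous g₀ := by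
      refine Metric.continuous_iff.2 fun τ₀ δ hδ => ?_
      obtain ⟨η, hη, h⟩ := hcont _ (hmax τ₀) δ hδ
      refine ⟨η, hη, fun τ hτ => (dist_weighted_le _ _ _ _).trans_lt (h _ (hmax τ) ?_)⟩
      exact (abs_max_sub_max_le_abs τ τ₀ (-T)).trans_lt hτ
    let g : ℝ →ᵇ (Rd d →ᵇ ℝ) := BoundedContinuousFunction.ofNormedAddCommGroup g₀ hg₀ K fun τ =>
      (norm_weighted_le _ _).trans (hK _ (hmax τ))
    have hg : ∀ τ, -T ≤ τ → unweight r (g τ) = m' τ := fun τ hτ => by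
      have : unweight r (weighted (m' (max τ (-T))) (hmem _ (hmax τ))) = m' τ := by
        rw [unweight_weighted, max_eq_left hτ]
      exact this
    have hgmild : ∀ τ, -T ≤ τ → ∀ s, g τ s
        = ∫ l in Set.Icc (-T) τ, duhamelIntegrand (fun s => 2 * gam d rstar s) (src g) τ s l :=
      fun τ hτ s => by
        rw [integral_duhamelIntegrand_eq (b := b) (y := m') (ε := ε) (r := r) fun l hl => by
          rw [hsrc, hg l hl.1], ← heq τ hτ s]
        change (1 + ‖s‖) ^ r * m' (max τ (-T)) s = _
        rw [max_eq_left hτ]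
    set R := max ‖f‖ ‖g‖
    have hfg := eq_of_duhamel_eq (k := ε * (L * R ^ 2)) hc1 (fun τ _ => hmild τ) hgmild
      (fun l => by
        have h0 : ‖src f l - src g l‖ = ε * ‖N f l - N g l‖ :=
          norm_add_smul_sub_add_smul B (N f l) (N g l) hε0
        rw [h0, hN, hN, mul_assoc]
        gcongr
        exact hA R _ _ ((f.norm_coe_le_norm l).trans (le_max_left _ _))
          ((g.norm_coe_le_norm l).trans (le_max_right _ _)))
      (by positivity) τ hτ
    change m' τ s = unweight r (f τ) s
    rw [hfg, hg τ hτ]
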